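/- Let (R, m) be a Noetherian local ring of prime characteristic p > 0 and let d be the Krull dimension of R. Then there exists an integer t ≥ 0 such that for all non-negative integers e and ℓ one has the inclusions m^(ℓ·pᵉ + d·(pᵉ−1) + 1 + t) ⊆ (m^(ℓ+1))^[pᵉ] ⊆ m^((ℓ+1)·pᵉ). -/

import Mathlib

/-- The `e`-th Frobenius power `a^[p^e]` of an ideal `a`: the ideal generated by the
`p^e`-th powers of the elements of `a`. -/
def frobeniusPower {R : Type*} [CommRing R] (p e : ℕ) (a : Ideal R) : Ideal R :=
  Ideal.span ((fun x => x ^ p ^ e) '' (a : Set R))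

open MvPolynomial in
/-- A homogeneous polynomial of degree `n` with coefficients in `K`, evaluated at elements of `I`,
takes values in `K * I ^ n`. -/
lemma MvPolynomial.IsHomogeneous.eval_mem_mul_pow {R σ : Type*} [CommRing R] {I K : Ideal R}
    {y : σ → R} (hy : ∀ j, y j ∈ I) {n : ℕ} {F : MvPolynomial σ R} (hF : F.IsHomogeneous n)
    (hK : ∀ a, coeff a F ∈ K) : eval y F ∈ K * I ^ n := by
  rw [eval_eq]
  refine Ideal.sum_mem _ fun a ha => Ideal.mul_mem_mul (hK a) ?_
  rw [hF.degree_eq_sum_deg_support ha, ← Finset.prod_pow_eq_pow_sum]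
  exact Ideal.prod_mem_prod fun j _ => Ideal.pow_mem_pow (hy j) _

open MvPolynomial in
lemma MvPolynomial.IsHomogeneous.eval_mul_const {R σ : Type*} [CommRing R] (w : σ → R) (u : R)
    {n : ℕ} {F : MvPolynomial σ R} (hF : F.IsHomogeneous n) :
    eval (fun j => w j * u) F = eval w F * u ^ n := by
  rw [eval_eq, eval_eq, Finset.sum_mul]
  refine Finset.sum_congr rfl fun a ha => ?_
  rw [hF.degree_eq_sum_deg_support ha, ← Finset.prod_pow_eq_pow_sum, mul_assoc,
    ← Finset.prod_mul_distrib]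
  simp_rw [mul_pow]

/-- If `y` and `z` are congruent modulo `J` then so are their monomials, with an extra factor in
the appropriate power of `I`. -/
lemma mul_prod_pow_sub_prod_pow_mem {R σ : Type*} [CommRing R] {I J : Ideal R} {y z : σ → R}
    (hy : ∀ j, y j ∈ I) (hz : ∀ j, z j ∈ I) (hyz : ∀ j, y j - z j ∈ J) {t : R} (ht : t ∈ I)
    (s : Multiset σ) :
    t * ((s.map y).prod - (s.map z).prod) ∈ J * I ^ s.card := by
  induction s using Multiset.induction_on with
  | empty => simp
  | cons j s ih =>
    have hzs : (s.map z).prod ∈ I ^ s.card := by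
      clear ih
      induction s using Multiset.induction_on with
      | empty => simp
      | cons k s ih => simpa [pow_succ'] using Ideal.mul_mem_mul (hz k) ih
    have h1 := Ideal.mul_mem_mul ih (hy j)
    have h2 := Ideal.mul_mem_mul (hyz j) (Ideal.mul_mem_mul hzs ht)
    rw [mul_assoc, ← pow_succ] at h1
    rw [← pow_succ] at h2
    convert! Ideal.add_mem _ h1 h2 using 1
    · rw [Multiset.card_cons]
    · rw [Multiset.map_cons, Multiset.map_cons, Multiset.prod_cons, Multiset.prod_cons]; ring

open MvPolynomial in
lemma MvPolynomial.IsHomogeneous.mul_eval_sub_eval_mem {R σ : Type*} [CommRing R] {I J : Ideal R}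
    {y z : σ → R} (hy : ∀ j, y j ∈ I) (hz : ∀ j, z j ∈ I) (hyz : ∀ j, y j - z j ∈ J)
    {t : R} (ht : t ∈ I) {n : ℕ} {F : MvPolynomial σ R} (hF : F.IsHomogeneous n) :
    t * (eval y F - eval z F) ∈ J * I ^ n := by
  classical
  rw [eval_eq, eval_eq, ← Finset.sum_sub_distrib, Finset.mul_sum]
  refine Ideal.sum_mem _ fun a ha => ?_
  have h := mul_prod_pow_sub_prod_pow_mem hy hz hyz ht a.toMultiset
  have hcard : a.toMultiset.card = n := by
    rw [Finsupp.card_toMultiset, hF.degree_eq_sum_deg_support ha]; rfl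
  simp only [hcard, Finset.prod_multiset_map_count, Finsupp.toFinset_toMultiset,
    Finsupp.count_toMultiset] at h
  rw [← mul_sub, mul_left_comm]
  exact Ideal.mul_mem_left _ _ h

lemma Ideal.sup_span_singleton_pow_le {R : Type*} [CommRing R] {I J : Ideal R} (hJ : J ≤ I) {u : R}
    (hu : u ∈ I) (n : ℕ) :
    (J ⊔ Ideal.span {u}) ^ (n + 1) ≤ J * I ^ n ⊔ Ideal.span {u ^ (n + 1)} := by
  induction n with
  | zero => simp
  | succ n ih =>
    have hs : J ⊔ Ideal.span {u} ≤ I := sup_le hJ (by simpa [Ideal.span_le] using hu)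
    rw [pow_succ]
    refine (Ideal.mul_mono_left ih).trans ?_
    rw [Ideal.sup_mul]
    refine sup_le ?_ ?_
    · rw [pow_succ, ← mul_assoc]
      exact le_sup_of_le_left (Ideal.mul_mono_right hs)
    · rw [Ideal.mul_sup, Ideal.span_singleton_mul_span_singleton, ← pow_succ]
      refine sup_le_sup ?_ le_rfl
      rw [mul_comm]
      refine Ideal.mul_mono_right ?_
      simpa [Ideal.span_le] using Ideal.pow_mem_pow hu (n + 1)

lemma Ideal.pow_add_le_of_pow_succ_le {R : Type*} [CommRing R] {I J : Ideal R} {c : ℕ}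
    (h : I ^ (c + 1) ≤ J * I ^ c) (n : ℕ) : I ^ (n + c) ≤ J ^ n * I ^ c := by
  induction n with
  | zero => simp
  | succ n ih =>
    rw [add_right_comm, pow_succ, pow_succ]
    refine (Ideal.mul_mono_left ih).trans ?_
    rw [mul_assoc, mul_assoc, ← pow_succ]
    exact Ideal.mul_mono_right h

open MvPolynomial IsLocalRing in
/-- A homogeneous relation between the generators of a reduction of the maximal ideal allows one to
discard one generator when the residue field is infinite. -/
lemma IsLocalRing.exists_reduction_of_relation {R : Type*} [CommRing R] [IsNoetherianRing R]
    [IsLocalRing R] [Infinite (ResidueField R)] {e c : ℕ} {y : Fin (e + 1) → R}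
    (hy : ∀ j, y j ∈ maximalIdeal R)
    (hc : maximalIdeal R ^ (c + 1) ≤ Ideal.span (Set.range y) * maximalIdeal R ^ c)
    {i : ℕ} {F : MvPolynomial (Fin (e + 1)) R} (hF : F.IsHomogeneous i)
    (hFy : eval y F ∈ maximalIdeal R ^ (i + 1)) (hF0 : F.map (residue R) ≠ 0) :
    ∃ (y' : Fin e → R) (c' : ℕ), (∀ j, y' j ∈ maximalIdeal R) ∧
      maximalIdeal R ^ (c' + 1) ≤ Ideal.span (Set.range y') * maximalIdeal R ^ c' := by
  obtain ⟨v, hv⟩ : ∃ v, eval v (F.map (residue R)) ≠ 0 := by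
    by_contra! h
    exact hF0 ((hF.map _).eq_zero_of_forall_eval_eq_zero h)
  obtain ⟨w, rfl⟩ : ∃ w : Fin (e + 1) → R, v = residue R ∘ w :=
    ⟨fun j => (residue_surjective (v j)).choose,
      funext fun j => (residue_surjective (v j)).choose_spec.symm⟩
  have hmap (x : Fin (e + 1) → R) : eval (residue R ∘ x) (F.map (residue R)) =
      residue R (eval x F) := by
    simp [eval_map, eval₂_comp]
  rw [hmap] at hv
  have hFw : IsUnit (eval w F) := by simpa using hv
  obtain ⟨j, hj⟩ : ∃ j, IsUnit (w j) := by
    by_contra! h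
    have hwy : residue R ∘ w = residue R ∘ y := by
      funext j
      rw [Function.comp, Function.comp, (residue_eq_zero_iff _).2 (hy j)]
      exact (residue_eq_zero_iff _).2 ((mem_maximalIdeal _).2 (h j))
    rw [← hmap, hwy, hmap] at hv
    exact hv ((residue_eq_zero_iff _).2 (Ideal.pow_le_self (by simp) hFy))
  obtain ⟨b, hb⟩ := hj.exists_right_inv
  set m := maximalIdeal R
  set u := b * y j with hu_def
  have hu : u ∈ m := Ideal.mul_mem_left _ _ (hy j)
  set y' : Fin e → R := fun l => y (j.succAbove l) - w (j.succAbove l) * u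
  have hy'm (l) : y' l ∈ m := Ideal.sub_mem _ (hy _) (Ideal.mul_mem_left _ _ hu)
  set J := Ideal.span (Set.range y')
  have hJm : J ≤ m := Ideal.span_le.2 (by rintro _ ⟨l, rfl⟩; exact hy'm l)
  have hsub (l) : y l - w l * u ∈ J := by
    rcases Fin.eq_self_or_eq_succAbove j l with rfl | ⟨l, rfl⟩
    · have : y l - w l * u = 0 := by rw [hu_def]; linear_combination (-y l) * hb
      rw [this]; exact J.zero_mem
    · exact Ideal.subset_span ⟨l, rfl⟩
  have hspan : Ideal.span (Set.range y) ≤ J ⊔ Ideal.span {u} := by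
    rw [Ideal.span_le]
    rintro _ ⟨l, rfl⟩
    rw [← sub_add_cancel (y l) (w l * u)]
    exact Ideal.add_mem _ (Ideal.mem_sup_left (hsub l))
      (Ideal.mem_sup_right (Ideal.mul_mem_left _ _ (Ideal.mem_span_singleton_self u)))
  have hui : u ^ (i + 1) ∈ J * m ^ i ⊔ m ^ (i + 2) := by
    have h1 := hF.mul_eval_sub_eval_mem hy (fun l => Ideal.mul_mem_left _ (w l) hu) hsub hu
    rw [hF.eval_mul_const] at h1
    have h2 : u * eval y F ∈ m ^ (i + 2) := by
      rw [pow_succ']; exact Ideal.mul_mem_mul hu hFy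
    refine (Ideal.unit_mul_mem_iff_mem _ hFw).1 ?_
    have : eval w F * u ^ (i + 1) = -(u * (eval y F - eval w F * u ^ i)) + u * eval y F := by ring
    rw [this]
    exact Ideal.add_mem _ (Ideal.mem_sup_left (neg_mem h1)) (Ideal.mem_sup_right h2)
  refine ⟨y', c + i, hy'm, ?_⟩
  refine Submodule.le_of_le_smul_of_le_jacobson_bot (I := m) (IsNoetherian.noetherian _)
    (maximalIdeal_le_jacobson _) ?_
  rw [smul_eq_mul]
  have h := Ideal.pow_add_le_of_pow_succ_le hc (i + 1)
  rw [add_comm, ← add_assoc] at h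
  calc m ^ (c + i + 1) ≤ Ideal.span (Set.range y) ^ (i + 1) * m ^ c := h
    _ ≤ (J * m ^ i ⊔ m ^ (i + 2)) * m ^ c := by
      refine Ideal.mul_mono_left (((Ideal.pow_right_mono hspan _).trans
        (Ideal.sup_span_singleton_pow_le hJm hu i)).trans (sup_le le_sup_left ?_))
      simpa [Ideal.span_le] using hui
    _ = J * m ^ (c + i) ⊔ m * m ^ (c + i + 1) := by
      rw [Ideal.sup_mul]; ring_nf

lemma Module.length_le_of_ker_le_ker {R A B C : Type*} [CommRing R] [AddCommGroup A]
    [AddCommGroup B] [AddCommGroup C] [Module R A] [Module R B] [Module R C] (f : A →ₗ[R] B)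
    (g : A →ₗ[R] C) (hg : Function.Surjective g) (h : LinearMap.ker f ≤ LinearMap.ker g) :
    Module.length R C ≤ Module.length R (LinearMap.range f) := by
  rw [← f.quotKerEquivRange.length_eq]
  refine Module.length_le_of_surjective ((LinearMap.ker f).liftQ g h) ?_
  rw [← LinearMap.range_eq_top, Submodule.range_liftQ, LinearMap.range_eq_top.2 hg]

lemma Ideal.length_quotient_pow_succ {R : Type*} [CommRing R] (I : Ideal R) (n : ℕ) :
    Module.length R (R ⧸ I ^ (n + 1)) =
      Module.length R (R ⧸ I ^ n) +
        Module.length R (Submodule.map (Submodule.mkQ (I ^ (n + 1))) (I ^ n)) := by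
  have hle : I ^ (n + 1) ≤ I ^ n := Ideal.pow_le_pow_right n.le_succ
  rw [add_comm (Module.length R (R ⧸ I ^ n))]
  refine Module.length_eq_add_of_exact (Submodule.subtype _) (Submodule.factor hle)
    (Submodule.subtype_injective _) (Submodule.factor_surjective hle) ?_
  rw [LinearMap.exact_iff, Submodule.range_subtype, Submodule.factor, Submodule.ker_mapQ]
  rfl

namespace MvPolynomial

/-- The coefficients modulo `I` of a homogeneous polynomial of degree `n` in `e` variables. -/
noncomputable def homogeneousCoeffs {R : Type*} [CommRing R] (I : Ideal R) (e n : ℕ) :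
    homogeneousSubmodule (Fin e) R n →ₗ[R]
      ((Finset.univ : Finset (Fin e)).finsuppAntidiag n → R ⧸ I) :=
  LinearMap.pi fun a => I.mkQ ∘ₗ lcoeff R a.1 ∘ₗ Submodule.subtype _

lemma homogeneousCoeffs_surjective {R : Type*} [CommRing R] (I : Ideal R) (e n : ℕ) :
    Function.Surjective (homogeneousCoeffs I e n) := by
  classical
  intro g
  choose r hr using fun a => Submodule.mkQ_surjective I (g a)
  refine ⟨⟨∑ a, monomial a.1 (r a), Submodule.sum_mem _ fun a _ => ?_⟩, ?_⟩
  · refine isHomogeneous_monomial _ ?_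
    have := (Finset.mem_finsuppAntidiag.1 a.2).1
    rw [Finsupp.degree_eq_sum]; exact this
  · funext b
    rw [← hr]
    simp [homogeneousCoeffs, coeff_monomial]

lemma homogeneousCoeffs_eq_zero_iff {R : Type*} [CommRing R] {I : Ideal R} {e n : ℕ}
    {F : homogeneousSubmodule (Fin e) R n} :
    homogeneousCoeffs I e n F = 0 ↔ ∀ a, coeff a F.1 ∈ I := by
  constructor
  · intro h a
    by_cases ha : a ∈ (Finset.univ : Finset (Fin e)).finsuppAntidiag n
    · have := congrFun h ⟨a, ha⟩
      simpa [homogeneousCoeffs, Ideal.Quotient.eq_zero_iff_mem] using this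
    · rw [IsHomogeneous.coeff_eq_zero F.2]
      · exact I.zero_mem
      · simpa [Finset.mem_finsuppAntidiag, Finsupp.degree_eq_sum] using ha
  · intro h
    funext a
    simpa [homogeneousCoeffs, Ideal.Quotient.eq_zero_iff_mem] using h a.1

/-- Evaluation of homogeneous polynomials of degree `n`, modulo `K`. -/
noncomputable def homogeneousEval {R : Type*} [CommRing R] (K : Ideal R) {e : ℕ} (y : Fin e → R)
    (n : ℕ) : homogeneousSubmodule (Fin e) R n →ₗ[R] R ⧸ K :=
  K.mkQ ∘ₗ (aeval y).toLinearMap ∘ₗ Submodule.subtype _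

lemma homogeneousEval_eq_zero_iff {R : Type*} [CommRing R] {K : Ideal R} {e : ℕ} {y : Fin e → R}
    {n : ℕ} {F : homogeneousSubmodule (Fin e) R n} :
    homogeneousEval K y n F = 0 ↔ eval y F.1 ∈ K := by
  simp [homogeneousEval, Ideal.Quotient.eq_zero_iff_mem, aeval_eq_eval]

lemma range_homogeneousEval {R : Type*} [CommRing R] (K : Ideal R) {e : ℕ} (y : Fin e → R)
    (n : ℕ) : LinearMap.range (homogeneousEval K y n) =
      Submodule.map K.mkQ (Ideal.span (Set.range y) ^ n) := by
  rw [homogeneousEval, LinearMap.range_comp, LinearMap.range_comp, Submodule.range_subtype]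
  congr 1
  ext r
  rw [Ideal.mem_span_pow_iff_exists_isHomogeneous]
  simp [aeval_eq_eval]

lemma length_pi_finsuppAntidiag {R M : Type*} [CommRing R] [AddCommGroup M] [Module R M]
    (e n : ℕ) :
    Module.length R ((Finset.univ : Finset (Fin e)).finsuppAntidiag n → M) =
      e.multichoose n * Module.length R M := by
  rw [Module.length_pi, ENat.card_eq_coe_fintype_card, Fintype.card_coe,
    Finset.card_finsuppAntidiag_nat_eq_multichoose, Finset.card_univ, Fintype.card_fin]

end MvPolynomial

open MvPolynomial in
/-- Upper bound for the Hilbert-Samuel function of an ideal with `d` generators. -/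
lemma Ideal.length_quotient_span_pow_le {R : Type*} [CommRing R] {d : ℕ} (x : Fin d → R) (n : ℕ) :
    Module.length R (R ⧸ Ideal.span (Set.range x) ^ n) ≤
      (∑ i ∈ Finset.range n, d.multichoose i : ℕ) *
        Module.length R (R ⧸ Ideal.span (Set.range x)) := by
  set I := Ideal.span (Set.range x)
  induction n with
  | zero =>
    have : Subsingleton (R ⧸ I ^ 0) := by
      rw [pow_zero]; exact Ideal.Quotient.subsingleton_iff.2 Ideal.one_eq_top
    simp [Module.length_eq_zero]
  | succ n ih =>
    rw [I.length_quotient_pow_succ, Finset.sum_range_succ, Nat.cast_add, add_mul]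
    refine add_le_add ih ?_
    rw [← length_pi_finsuppAntidiag, ← range_homogeneousEval]
    refine (Module.length_le_of_ker_le_ker (homogeneousCoeffs I d n)
      (homogeneousEval (I ^ (n + 1)) x n).rangeRestrict
      (LinearMap.surjective_rangeRestrict _) ?_).trans
      (Module.length_le_of_injective _ (Submodule.subtype_injective _))
    intro F hF
    rw [LinearMap.ker_rangeRestrict, LinearMap.mem_ker, homogeneousEval_eq_zero_iff, pow_succ']
    exact IsHomogeneous.eval_mem_mul_pow (fun j => Ideal.subset_span (Set.mem_range_self j)) F.2
      (homogeneousCoeffs_eq_zero_iff.1 hF)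

open MvPolynomial in
/-- Lower bound for the Hilbert-Samuel function of an ideal `I` containing `e` analytically
independent elements. -/
lemma Ideal.le_length_quotient_pow {R : Type*} [CommRing R] {I : Ideal R} {e : ℕ} {y : Fin e → R}
    (hy : ∀ j, y j ∈ I)
    (h : ∀ (n : ℕ) (F : MvPolynomial (Fin e) R), F.IsHomogeneous n → eval y F ∈ I ^ (n + 1) →
      ∀ a, coeff a F ∈ I) (n : ℕ) :
    (∑ i ∈ Finset.range n, e.multichoose i : ℕ) * Module.length R (R ⧸ I) ≤
      Module.length R (R ⧸ I ^ n) := by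
  induction n with
  | zero => simp
  | succ n ih =>
    rw [I.length_quotient_pow_succ, Finset.sum_range_succ, Nat.cast_add, add_mul]
    refine add_le_add ih ?_
    rw [← length_pi_finsuppAntidiag]
    have hle : LinearMap.range (homogeneousEval (I ^ (n + 1)) y n) ≤
        Submodule.map (Submodule.mkQ (I ^ (n + 1))) (I ^ n) := by
      rw [range_homogeneousEval]
      refine Submodule.map_mono (Ideal.pow_right_mono (Ideal.span_le.2 ?_) n)
      rintro _ ⟨j, rfl⟩
      exact hy j
    refine (Module.length_le_of_ker_le_ker (homogeneousEval (I ^ (n + 1)) y n)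
      (homogeneousCoeffs I e n) (homogeneousCoeffs_surjective I e n) ?_).trans
      (Module.length_le_of_injective _ (Submodule.inclusion_injective hle))
    intro F hF
    exact homogeneousCoeffs_eq_zero_iff.2 (h n F.1 F.2 (homogeneousEval_eq_zero_iff.1 hF))

lemma Nat.exists_mul_sum_multichoose_lt (L d : ℕ) :
    ∃ n, L * ∑ i ∈ Finset.range n, d.multichoose i <
      ∑ i ∈ Finset.range n, (d + 1).multichoose i := by
  refine ⟨L * (d + 1) + 1, ?_⟩
  rw [Nat.sum_range_multichoose, Nat.sum_range_multichoose]
  have h := Nat.add_one_mul_choose_eq (L * (d + 1) + d) d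
  have hpos : 0 < (L * (d + 1) + d).choose d := Nat.choose_pos (Nat.le_add_left _ _)
  rw [← add_assoc]
  refine Nat.lt_of_mul_lt_mul_right (a := d + 1) ?_
  rw [← h]
  nlinarith

lemma Nat.multichoose_le_multichoose {d e : ℕ} (h : d ≤ e) (n : ℕ) :
    d.multichoose n ≤ e.multichoose n := by
  rw [Nat.multichoose_eq, Nat.multichoose_eq]
  exact Nat.choose_le_choose _ (by omega)

open IsLocalRing in
lemma IsLocalRing.length_quotient_ne_top_of_pow_le {R : Type*} [CommRing R] [IsNoetherianRing R]
    [IsLocalRing R] {I : Ideal R} {s : ℕ} (h : maximalIdeal R ^ s ≤ I) :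
    Module.length R (R ⧸ I) ≠ ⊤ := by
  obtain ⟨N, z, hz⟩ := Submodule.fg_iff_exists_fin_generating_family.1
    (IsNoetherian.noetherian (maximalIdeal R))
  have hle := Ideal.length_quotient_span_pow_le z s
  have hone : Module.length R (R ⧸ maximalIdeal R) = 1 :=
    have : IsSimpleModule R (R ⧸ maximalIdeal R) :=
      isSimpleModule_iff_isCoatom.2 (Ideal.isMaximal_def.1 inferInstance)
    Module.length_eq_one R _
  rw [Ideal.span, hz, hone, mul_one] at hle
  exact ne_top_of_le_ne_top (ne_top_of_le_ne_top (ENat.natCast_ne_top _) hle)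
    (Module.length_le_of_surjective _ (Submodule.factor_surjective h))

open MvPolynomial IsLocalRing in
/-- If the maximal ideal is the radical of an ideal with `d` generators, then more than `d` of its
elements are analytically dependent. -/
lemma IsLocalRing.exists_relation {R : Type*} [CommRing R] [IsNoetherianRing R] [IsLocalRing R]
    {d e s : ℕ} {x : Fin d → R} (hxm : ∀ j, x j ∈ maximalIdeal R)
    (hx : maximalIdeal R ^ s ≤ Ideal.span (Set.range x)) (hde : d < e)
    {y : Fin e → R} (hy : ∀ j, y j ∈ maximalIdeal R) :
    ∃ (i : ℕ) (F : MvPolynomial (Fin e) R), F.IsHomogeneous i ∧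
      eval y F ∈ maximalIdeal R ^ (i + 1) ∧ F.map (residue R) ≠ 0 := by
  by_contra! h
  have hlow := Ideal.le_length_quotient_pow hy fun n F hF hFy a => by
    rw [← residue_eq_zero_iff, ← coeff_map, h n F hF hFy, coeff_zero]
  obtain ⟨L, hL⟩ := ENat.ne_top_iff_exists.1 (length_quotient_ne_top_of_pow_le hx)
  obtain ⟨n, hn⟩ := Nat.exists_mul_sum_multichoose_lt L d
  have hle : Ideal.span (Set.range x) ^ n ≤ maximalIdeal R ^ n :=
    Ideal.pow_right_mono (Ideal.span_le.2 (Set.range_subset_iff.2 hxm)) n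
  have hpos : 1 ≤ Module.length R (R ⧸ maximalIdeal R) := by
    rw [Order.one_le_iff_ne_zero, ← pos_iff_ne_zero, Module.length_pos_iff]
    exact Ideal.Quotient.nontrivial_iff.2 (Ideal.IsPrime.ne_top inferInstance)
  have key := calc
    ((∑ i ∈ Finset.range n, (d + 1).multichoose i : ℕ) : ℕ∞)
      ≤ (∑ i ∈ Finset.range n, e.multichoose i : ℕ) :=
        Nat.cast_le.2 (Finset.sum_le_sum fun i _ => Nat.multichoose_le_multichoose hde i)
    _ ≤ _ := le_mul_of_one_le_right zero_le hpos
    _ ≤ _ := hlow n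
    _ ≤ Module.length R (R ⧸ Ideal.span (Set.range x) ^ n) :=
        Module.length_le_of_surjective (Submodule.factor hle) (Submodule.factor_surjective hle)
    _ ≤ _ := Ideal.length_quotient_span_pow_le x n
    _ = ((L * ∑ i ∈ Finset.range n, d.multichoose i : ℕ) : ℕ∞) := by
        rw [← hL, mul_comm, Nat.cast_mul]
  exact hn.not_ge (Nat.cast_le.1 key)

open IsLocalRing in
/-- If the residue field is infinite and the maximal ideal is the radical of an ideal with `d`
generators, then it has a reduction generated by at most `d` elements. -/
lemma IsLocalRing.exists_reduction {R : Type*} [CommRing R] [IsNoetherianRing R] [IsLocalRing R]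
    [Infinite (ResidueField R)] {d s : ℕ} {x : Fin d → R}
    (hxm : ∀ j, x j ∈ maximalIdeal R)
    (hx : maximalIdeal R ^ s ≤ Ideal.span (Set.range x)) :
    ∃ e ≤ d, ∃ (y : Fin e → R) (c : ℕ), (∀ j, y j ∈ maximalIdeal R) ∧
      ∀ n, maximalIdeal R ^ (n + c) ≤ Ideal.span (Set.range y) ^ n := by
  have hex : ∃ (e : ℕ) (y : Fin e → R) (c : ℕ), (∀ j, y j ∈ maximalIdeal R) ∧
      maximalIdeal R ^ (c + 1) ≤ Ideal.span (Set.range y) * maximalIdeal R ^ c := by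
    obtain ⟨N, z, hz⟩ := Submodule.fg_iff_exists_fin_generating_family.1
      (IsNoetherian.noetherian (maximalIdeal R))
    refine ⟨N, z, 0, fun j => hz ▸ Submodule.subset_span ⟨j, rfl⟩, ?_⟩
    rw [Ideal.span, hz]
    simp
  classical
  obtain ⟨y, c, hy, hc⟩ := Nat.find_spec hex
  refine ⟨Nat.find hex, ?_, y, c, hy, fun n => ?_⟩
  · by_contra! hlt
    obtain ⟨i, F, hF, hFy, hF0⟩ := exists_relation hxm hx hlt hy
    obtain ⟨e, he⟩ := Nat.exists_eq_succ_of_ne_zero (Nat.ne_zero_of_lt hlt)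
    have hmin := Nat.find_min hex (m := e) (by omega)
    generalize Nat.find hex = e' at *
    subst he
    exact hmin (exists_reduction_of_relation hy hc hF hFy hF0)
  · exact (Ideal.pow_add_le_of_pow_succ_le hc n).trans Ideal.mul_le_left

open MvPolynomial in
/-- Pigeonhole principle for ordinary and Frobenius powers of an ideal with `d` generators. -/
lemma span_range_pow_le_frobeniusPower {R : Type*} [CommRing R] {p : ℕ} (hp : 0 < p) {d : ℕ}
    (y : Fin d → R) (e l : ℕ) :
    Ideal.span (Set.range y) ^ (l * p ^ e + d * (p ^ e - 1) + 1) ≤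
      frobeniusPower p e (Ideal.span (Set.range y) ^ (l + 1)) := by
  intro r hr
  obtain ⟨F, hF, rfl⟩ := (Ideal.mem_span_pow_iff_exists_isHomogeneous y r).1 hr
  set q := p ^ e
  have hq : 0 < q := pow_pos hp e
  rw [eval_eq']
  refine Ideal.sum_mem _ fun a ha => Ideal.mul_mem_left _ _ ?_
  have hdeg : l * q + d * (q - 1) + 1 = ∑ i, a i := by
    rw [← Finsupp.degree_eq_sum]
    exact hF.degree_eq_sum_deg_support ha
  have hsplit : ∏ i, y i ^ a i = (∏ i, y i ^ (a i % q)) * (∏ i, y i ^ (a i / q)) ^ q := by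
    rw [← Finset.prod_pow, ← Finset.prod_mul_distrib]
    refine Finset.prod_congr rfl fun i _ => ?_
    rw [← pow_mul, ← pow_add, mul_comm, Nat.mod_add_div]
  have hsum : l + 1 ≤ ∑ i, a i / q := by
    have h1 : ∑ i, a i ≤ q * (∑ i, a i / q) + d * (q - 1) := by
      calc ∑ i, a i = ∑ i, (q * (a i / q) + a i % q) :=
            Finset.sum_congr rfl fun i _ => (Nat.div_add_mod _ _).symm
        _ ≤ ∑ i, (q * (a i / q) + (q - 1)) :=
            Finset.sum_le_sum fun i _ => by
              have := Nat.mod_lt (a i) hq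
              omega
        _ = _ := by simp [Finset.sum_add_distrib, Finset.mul_sum]
    by_contra! hlt
    have : q * (∑ i, a i / q) ≤ q * l := Nat.mul_le_mul_left _ (by omega)
    rw [mul_comm q l] at this
    omega
  rw [hsplit]
  refine Ideal.mul_mem_left _ _ (Ideal.subset_span ⟨_, ?_, rfl⟩)
  refine Ideal.pow_le_pow_right hsum ?_
  rw [← Finset.prod_pow_eq_pow_sum]
  exact Ideal.prod_mem_prod fun i _ =>
    Ideal.pow_mem_pow (Ideal.subset_span (Set.mem_range_self i)) _

lemma frobeniusPower_mono {R : Type*} [CommRing R] (p e : ℕ) {I J : Ideal R} (h : I ≤ J) :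
    frobeniusPower p e I ≤ frobeniusPower p e J :=
  Ideal.span_mono (Set.image_mono h)

lemma frobeniusPower_map_le {R S : Type*} [CommRing R] [CommRing S] (p : ℕ) [ExpChar R p]
    [ExpChar S p] (e : ℕ) (f : R →+* S) (I : Ideal R) :
    frobeniusPower p e (I.map f) ≤ (frobeniusPower p e I).map f := by
  change (I.map f).map (iterateFrobenius S p e) ≤ (I.map (iterateFrobenius R p e)).map f
  rw [Ideal.map_map, Ideal.map_map, RingHom.iterateFrobenius_comm]

lemma frobeniusPower_pow_le {R : Type*} [CommRing R] (p e : ℕ) (I : Ideal R) (n : ℕ) :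
    frobeniusPower p e (I ^ n) ≤ I ^ (n * p ^ e) := by
  refine Ideal.span_le.2 ?_
  rintro _ ⟨x, hx, rfl⟩
  rw [pow_mul]
  exact Ideal.pow_mem_pow hx _

universe u in
open IsLocalRing in
/-- The purely transcendental residue field extension `R → R[X]_{m[X]}` is an extension
with infinite residue field along which ideals contract to themselves. -/
lemma IsLocalRing.exists_infinite_residueField (R : Type u) [CommRing R] [IsNoetherianRing R]
    [IsLocalRing R] :
    ∃ (S : Type u) (_ : CommRing S) (_ : IsNoetherianRing S) (_ : IsLocalRing S) (f : R →+* S),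
      Infinite (ResidueField S) ∧ (maximalIdeal R).map f = maximalIdeal S ∧
        ∀ I : Ideal R, (I.map f).comap f ≤ I := by
  set P : Ideal (Polynomial R) := (maximalIdeal R).map Polynomial.C
  set S := Localization.AtPrime P
  have hmem (g : Polynomial R) (i : ℕ) (hg : IsUnit (g.coeff i)) : g ∉ P := fun h =>
    (mem_maximalIdeal _).1 (Ideal.mem_map_C_iff.1 h i) hg
  refine ⟨S, inferInstance, IsLocalization.isNoetherianRing P.primeCompl S inferInstance,
    inferInstance, (algebraMap (Polynomial R) S).comp Polynomial.C, ?_, ?_, ?_⟩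
  · refine Infinite.of_injective
      (fun n : ℕ => residue S (algebraMap (Polynomial R) S (Polynomial.X ^ n))) fun i j hij => ?_
    by_contra hne
    rw [← sub_eq_zero, ← map_sub, ← map_sub, residue_eq_zero_iff,
      IsLocalization.AtPrime.to_map_mem_maximal_iff S P] at hij
    exact hmem _ i (by simp [Polynomial.coeff_X_pow, hne]) hij
  · rw [← Ideal.map_map, Localization.AtPrime.map_eq_maximalIdeal]
  · intro I a ha
    rw [Ideal.mem_comap, ← Ideal.map_map, RingHom.comp_apply,
      IsLocalization.algebraMap_mem_map_algebraMap_iff P.primeCompl] at ha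
    obtain ⟨g, hg, hga⟩ := ha
    obtain ⟨i, hi⟩ : ∃ i, IsUnit (g.coeff i) := by
      by_contra! h
      exact hg (Ideal.mem_map_C_iff.2 fun i => (mem_maximalIdeal _).2 (h i))
    have := Ideal.mem_map_C_iff.1 hga i
    rw [Polynomial.coeff_mul_C] at this
    exact (Ideal.unit_mul_mem_iff_mem _ hi).1 this

open IsLocalRing in
lemma IsLocalRing.exists_pow_le_span_of_ringKrullDim_eq {R : Type*} [CommRing R]
    [IsNoetherianRing R] [IsLocalRing R] {d : ℕ} (hd : ringKrullDim R = d) :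
    ∃ (x : Fin d → R) (s : ℕ), (∀ j, x j ∈ maximalIdeal R) ∧
      maximalIdeal R ^ s ≤ Ideal.span (Set.range x) := by
  obtain ⟨t, ht, hcard⟩ :=
    Ideal.exists_finset_card_eq_height_of_isNoetherianRing (maximalIdeal R)
  have htd : t.card = d := by
    rw [← maximalIdeal_height_eq_ringKrullDim, ← hcard] at hd
    exact_mod_cast hd
  have hrad : maximalIdeal R ≤ (Ideal.span (t : Set R)).radical := by
    rw [Ideal.radical_eq_sInf]
    refine le_sInf fun J ⟨hJ, hJp⟩ => ?_
    exact ht.2 ⟨hJp, hJ⟩ (le_maximalIdeal hJp.ne_top)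
  obtain ⟨s, hs⟩ := Ideal.exists_pow_le_of_le_radical_of_fg hrad (IsNoetherian.noetherian _)
  refine ⟨fun i => (t.equivFinOfCardEq htd).symm i, s,
    fun j => ht.1.2 (Ideal.subset_span (Subtype.coe_prop _)),
    hs.trans (Ideal.span_mono fun r hr => ?_)⟩
  exact ⟨t.equivFinOfCardEq htd ⟨r, hr⟩, by simp⟩

/-- Let `(R, m)` be a Noetherian local ring of prime characteristic `p > 0` of Krull
dimension `d`. Then there is an integer `t ≥ 0` such that for all `e, ℓ ≥ 0` we have
`m^(ℓ·pᵉ + d·(pᵉ−1) + 1 + t) ⊆ (m^(ℓ+1))^[pᵉ] ⊆ m^((ℓ+1)·pᵉ)`. -/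
theorem exists_pigeonhole_frobeniusPower_maximalIdeal
    {R : Type*} [CommRing R] [IsNoetherianRing R] [IsLocalRing R]
    (p : ℕ) (hp : p.Prime) [CharP R p]
    (d : ℕ) (hd : ringKrullDim R = d) :
    ∃ t : ℕ, ∀ e ℓ : ℕ,
      IsLocalRing.maximalIdeal R ^ (ℓ * p ^ e + d * (p ^ e - 1) + 1 + t) ≤
        frobeniusPower p e (IsLocalRing.maximalIdeal R ^ (ℓ + 1)) ∧
      frobeniusPower p e (IsLocalRing.maximalIdeal R ^ (ℓ + 1)) ≤
        IsLocalRing.maximalIdeal R ^ ((ℓ + 1) * p ^ e) := by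
  obtain ⟨x, s, hxm, hx⟩ := IsLocalRing.exists_pow_le_span_of_ringKrullDim_eq hd
  obtain ⟨S, _, _, _, f, _, hmax, hcontr⟩ := IsLocalRing.exists_infinite_residueField R
  have : CharP S p := (CharP.charP_iff_prime_eq_zero hp).2 <| by
    rw [← map_natCast f, CharP.cast_eq_zero, map_zero]
  have := ExpChar.prime (R := R) hp
  have := ExpChar.prime (R := S) hp
  have hxS : IsLocalRing.maximalIdeal S ^ s ≤ Ideal.span (Set.range (f ∘ x)) := by
    rw [← hmax, ← Ideal.map_pow, Set.range_comp, ← Ideal.map_span]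
    exact Ideal.map_mono hx
  obtain ⟨d', hd', y, c, hy, hc⟩ := IsLocalRing.exists_reduction
    (fun j => hmax ▸ Ideal.mem_map_of_mem f (hxm j)) hxS
  refine ⟨c, fun e ℓ => ⟨?_, frobeniusPower_pow_le p e _ _⟩⟩
  refine (Ideal.map_le_iff_le_comap.1 ?_).trans (hcontr _)
  refine le_trans ?_ (frobeniusPower_map_le p e f _)
  rw [Ideal.map_pow, Ideal.map_pow, hmax]
  calc _ ≤ IsLocalRing.maximalIdeal S ^ (ℓ * p ^ e + d' * (p ^ e - 1) + 1 + c) :=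
        Ideal.pow_le_pow_right (by gcongr)
    _ ≤ Ideal.span (Set.range y) ^ (ℓ * p ^ e + d' * (p ^ e - 1) + 1) := hc _
    _ ≤ frobeniusPower p e (Ideal.span (Set.range y) ^ (ℓ + 1)) :=
        span_range_pow_le_frobeniusPower hp.pos y e ℓ
    _ ≤ _ := frobeniusPower_mono p e (Ideal.pow_right_mono (Ideal.span_le.2
        (Set.range_subset_iff.2 hy)) _)
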